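/- For all positive integers n, m, k with m < n and all ε > 0, there exist positive integers N₁, N₂ such that the following holds. If there exists a (possibly randomized) tester A that, taking m samples produced by labeled order-type sampling from every pair of distributions p, q over [N₁] × [N₂], distinguishes p = q from ‖p − q‖_{A_k} > ε with probability at least 4/5, then there exists an order-based tester A′ — i.e., a (possibly randomized) function of the order tuple alone — that for every pair of distributions p′, q′ over [n] × [n] distinguishes p′ = q′ from ‖p′ − q′‖_{A_k} > ε with probability at least 2/3, given as input an order tuple drawn from the order-sampling distribution D(p′, q′, m). -/

import Mathlib

open MeasureTheory
open scoped ENNReal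

/-- An axis-aligned rectangle in `ℝ²` is a product of two intervals. -/
def IsRect2 (R : Set (ℝ × ℝ)) : Prop :=
  ∃ I J : Set ℝ, I.OrdConnected ∧ J.OrdConnected ∧ R = I ×ˢ J

/-- The `A_k` distance between two measures on `ℝ²`. -/
noncomputable def AkDist2 (k : ℕ) (p q : Measure (ℝ × ℝ)) : ℝ :=
  ⨆ R : {R : Fin k → Set (ℝ × ℝ) //
      (∀ i, IsRect2 (R i)) ∧ Pairwise fun i j => Disjoint (R i) (R j)},
    ∑ i, |(p (R.1 i)).toReal - (q (R.1 i)).toReal|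

/-- A measure on `ℝ²` supported on the grid `[N₁] × [N₂]`. -/
def GridSupported2 (N₁ N₂ : ℕ) (p : Measure (ℝ × ℝ)) : Prop :=
  p {z : ℝ × ℝ | ∃ i : Fin N₁, ∃ j : Fin N₂, z = ((i : ℝ) + 1, (j : ℝ) + 1)}ᶜ = 0

/-- Labeled sampling from a pair of distributions `(p, q)` on `ℝ²`. -/
noncomputable def labeledSamples (m : ℕ) (p q : Measure (ℝ × ℝ)) :
    Measure ((Fin m → ℝ × ℝ) × (Fin m → Bool)) :=
  ((PMF.uniformOfFintype (Fin m → Bool)).toMeasure).bind fun ℓ =>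
    (Measure.pi fun i => if ℓ i then q else p).map fun xs => (xs, ℓ)

/-- The order tuple of a labeled sample (ranks of `x`- and `y`-coordinates, with ties
broken by index, and the labels). -/
noncomputable def orderTuple (m : ℕ) (s : (Fin m → ℝ × ℝ) × (Fin m → Bool)) :
    (Fin m → ℕ) × (Fin m → ℕ) × (Fin m → Bool) :=
  (fun i => (Finset.univ.filter fun j =>
      (s.1 j).1 < (s.1 i).1 ∨ ((s.1 j).1 = (s.1 i).1 ∧ j < i)).card,
   fun i => (Finset.univ.filter fun j =>
      (s.1 j).2 < (s.1 i).2 ∨ ((s.1 j).2 = (s.1 i).2 ∧ j < i)).card,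
   s.2)

/-- `D(p, q, m)`: the distribution of the order tuple of `m` labeled samples. -/
noncomputable def orderDist (m : ℕ) (p q : Measure (ℝ × ℝ)) :
    Measure ((Fin m → ℕ) × (Fin m → ℕ) × (Fin m → Bool)) :=
  (labeledSamples m p q).map (orderTuple m)

/-- Hypergraph Ramsey theorem, finite form: colourings of `r`-subsets by a finite type. -/
theorem exists_card_forall_homogeneous {κ : Type*} [Finite κ] (r n : ℕ) :
    ∃ N : ℕ, ∀ S : Finset ℕ, N ≤ S.card → ∀ c : Finset ℕ → κ,
      ∃ H ⊆ S, H.card = n ∧ ∃ v, ∀ T ⊆ H, T.card = r → c T = v := by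
  classical
  have := Fintype.ofFinite κ
  induction r generalizing n with
  | zero =>
    refine ⟨n, fun S hS c => ?_⟩
    obtain ⟨H, hHS, hH⟩ := Finset.exists_subset_card_eq hS
    exact ⟨H, hHS, hH, c ∅, fun T _ hT => by rw [Finset.card_eq_zero.1 hT]⟩
  | succ r ih =>
    have pre : ∀ t : ℕ, ∃ N : ℕ, ∀ S : Finset ℕ, N ≤ S.card → ∀ c : Finset ℕ → κ,
        ∃ P ⊆ S, P.card = t ∧ ∃ g : ℕ → κ,
          ∀ T ⊆ P, T.card = r + 1 → ∃ x ∈ T, c T = g x := by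
      intro t
      induction t with
      | zero =>
        refine ⟨0, fun S _ c => ⟨∅, by simp, rfl, fun _ => c ∅, fun T hT hc => ?_⟩⟩
        rw [Finset.subset_empty.1 hT] at hc
        simp at hc
      | succ t iht =>
        obtain ⟨N, hN⟩ := iht
        obtain ⟨N', hN'⟩ := ih N
        refine ⟨N' + 1, fun S hS c => ?_⟩
        obtain ⟨x, hx⟩ : S.Nonempty := Finset.card_pos.1 (by omega)
        obtain ⟨H, hHS, hH, v, hv⟩ := hN' (S.erase x)
          (by rw [Finset.card_erase_of_mem hx]; omega) (fun T => c (insert x T))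
        obtain ⟨P, hPH, hP, g, hg⟩ := hN H hH.ge c
        have hxP : x ∉ P := fun h => by simpa using hHS (hPH h)
        refine ⟨insert x P, ?_, by rw [Finset.card_insert_of_notMem hxP, hP],
          Function.update g x v, fun T hT hTc => ?_⟩
        · exact Finset.insert_subset hx
            (hPH.trans (hHS.trans (Finset.erase_subset _ _)))
        · by_cases hxT : x ∈ T
          · refine ⟨x, hxT, ?_⟩
            have := hv (T.erase x) ((Finset.subset_insert_iff.1 hT).trans hPH)
              (by rw [Finset.card_erase_of_mem hxT]; omega)
            simpa [Finset.insert_erase hxT] using this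
          · obtain ⟨y, hy, h⟩ := hg T ((Finset.subset_insert_iff_of_notMem hxT).1 hT) hTc
            refine ⟨y, hy, ?_⟩
            rw [Function.update_of_ne (by rintro rfl; exact hxT hy), h]
    obtain ⟨N, hN⟩ := pre (Fintype.card κ * n + 1)
    refine ⟨N, fun S hS c => ?_⟩
    obtain ⟨P, hPS, hP, g, hg⟩ := hN S hS c
    obtain ⟨v, -, hv⟩ := Finset.exists_lt_card_fiber_of_mul_lt_card_of_maps_to
      (s := P) (t := Finset.univ) (f := g) (n := n) (fun _ _ => Finset.mem_univ _)
      (by rw [hP, Finset.card_univ]; omega)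
    obtain ⟨H, hHP, hH⟩ := Finset.exists_subset_card_eq hv.le
    refine ⟨H, fun y hy => hPS (Finset.mem_filter.1 (hHP hy)).1, hH, v, fun T hT hTc => ?_⟩
    obtain ⟨x, hx, h⟩ := hg T (fun y hy => (Finset.mem_filter.1 (hHP (hT hy))).1) hTc
    rw [h, (Finset.mem_filter.1 (hHP (hT hx))).2]

/-- Hypergraph Ramsey theorem for colourings of increasing `r`-tuples, the homogeneous set
being enumerated by a strictly increasing function. -/
theorem exists_strictMono_homogeneous (κ : Type*) [Finite κ] (r M : ℕ) :
    ∃ N : ℕ, ∀ C : (Fin r → ℕ) → κ, ∃ E : ℕ → ℕ, StrictMono E ∧ (∀ a < M, E a < N) ∧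
      ∃ v, ∀ t : Fin r → ℕ, StrictMono t → (∀ i, t i < M) → C (E ∘ t) = v := by
  classical
  obtain ⟨N, hN⟩ := exists_card_forall_homogeneous (κ := κ) r M
  refine ⟨N, fun C => ?_⟩
  obtain ⟨H, hHN, hH, v, hv⟩ := hN (Finset.range N) (by simp)
    (fun T => if h : T.card = r then C (T.orderEmbOfFin h) else C 0)
  have hlt : ∀ i, H.orderEmbOfFin hH i < N := fun i =>
    Finset.mem_range.1 (hHN (Finset.orderEmbOfFin_mem H hH i))
  let E : ℕ → ℕ := fun a => if h : a < M then H.orderEmbOfFin hH ⟨a, h⟩ else N + a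
  have hE : StrictMono E := by
    intro a b hab
    by_cases hb : b < M
    · have ha : a < M := hab.trans hb
      simp only [E, dif_pos ha, dif_pos hb]
      exact (H.orderEmbOfFin hH).strictMono hab
    · by_cases ha : a < M
      · simp only [E, dif_pos ha, dif_neg hb]
        have := hlt ⟨a, ha⟩
        omega
      · simp only [E, dif_neg ha, dif_neg hb]
        omega
  refine ⟨E, hE, fun a ha => by simpa only [E, dif_pos ha] using hlt ⟨a, ha⟩, v,
    fun t ht htM => ?_⟩
  have hmono : StrictMono (E ∘ t) := hE.comp ht
  have hc : (Finset.univ.image (E ∘ t)).card = r := by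
    rw [Finset.card_image_of_injective _ hmono.injective, Finset.card_univ, Fintype.card_fin]
  have key := hv (Finset.univ.image (E ∘ t)) (fun y hy => by
    obtain ⟨i, -, rfl⟩ := Finset.mem_image.1 hy
    simp only [Function.comp, E, dif_pos (htM i)]
    exact Finset.orderEmbOfFin_mem H hH _) hc
  rw [dif_pos hc, ← Finset.orderEmbOfFin_unique hc
    (fun i => Finset.mem_image_of_mem _ (Finset.mem_univ i)) hmono] at key
  exact key

/-- An injective tuple is an increasing tuple composed with its rank function. -/
theorem exists_strictMono_comp_rank {m : ℕ} (a : Fin m → ℕ) (ha : Function.Injective a) :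
    ∃ t : Fin m → ℕ, StrictMono t ∧ (∀ i, t i ∈ Set.range a) ∧ ∃ σ : Fin m → Fin m,
      a = t ∘ σ ∧ ∀ i, (σ i : ℕ) = (Finset.univ.filter fun j => a j < a i).card := by
  have ht : StrictMono (a ∘ Tuple.sort a) :=
    (Tuple.monotone_sort a).strictMono_of_injective (ha.comp (Tuple.sort a).injective)
  refine ⟨a ∘ Tuple.sort a, ht, fun i => ⟨_, rfl⟩, (Tuple.sort a).symm,
    by ext i; simp, fun i => ?_⟩
  rw [← Fin.card_Iio]
  refine Finset.card_equiv (Tuple.sort a) fun j => ?_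
  have := ht.lt_iff_lt (a := j) (b := (Tuple.sort a).symm i)
  simp only [Function.comp, Equiv.apply_symm_apply] at this
  simp [this]

/-- Most tuples in a large alphabet are injective. -/
theorem card_not_injective_le (m L : ℕ) (hm : 0 < m) (hL : m ≤ L) :
    ((Finset.univ.filter fun u : Fin m → Fin L => ¬ Function.Injective u).card : ℝ) ≤
      m * m / L * (L : ℝ) ^ m := by
  classical
  have h1 : (Finset.univ.filter fun u : Fin m → Fin L => Function.Injective u).card
      = L.descFactorial m := by
    rw [← Fintype.card_subtype, Fintype.card_congr (Equiv.subtypeInjectiveEquivEmbedding _ _),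
      Fintype.card_embedding_eq, Fintype.card_fin, Fintype.card_fin]
  have h2 := Finset.card_filter_add_card_filter_not (s := (Finset.univ : Finset (Fin m → Fin L)))
    (fun u => Function.Injective u)
  rw [h1, Finset.card_univ, Fintype.card_fun, Fintype.card_fin, Fintype.card_fin] at h2
  have h3 : ((L : ℝ) - m) ^ m ≤ L.descFactorial m := by
    have : (L - m) ^ m ≤ L.descFactorial m :=
      (Nat.pow_le_pow_left (by omega) m).trans (Nat.pow_sub_le_descFactorial L m)
    calc ((L : ℝ) - m) ^ m = (((L - m) ^ m : ℕ) : ℝ) := by push_cast [Nat.cast_sub hL]; ring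
      _ ≤ _ := by exact_mod_cast this
  have hL0 : (0 : ℝ) < L := by exact_mod_cast hm.trans_le hL
  have hmL : (m : ℝ) / L ≤ 1 := by
    rw [div_le_one hL0]
    exact_mod_cast hL
  have h4 := one_add_mul_le_pow (a := -((m : ℝ) / L)) (by linarith) m
  have h5 : ((L : ℝ) - m) ^ m = (1 + -((m : ℝ) / L)) ^ m * (L : ℝ) ^ m := by
    rw [← mul_pow]
    congr 1
    field_simp
    ring
  have h6 : (L.descFactorial m : ℝ) +
      (Finset.univ.filter fun u : Fin m → Fin L => ¬ Function.Injective u).card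
      = (L : ℝ) ^ m := by exact_mod_cast h2
  have h7 := mul_le_mul_of_nonneg_right h4 (pow_nonneg hL0.le m)
  rw [← h5] at h7
  have h8 : (m : ℝ) * m / L * (L : ℝ) ^ m = m * (m / L) * (L : ℝ) ^ m := by ring
  rw [h8]
  linarith

/-- Strictly increasing block enumerations have a monotone left inverse onto block numbers. -/
theorem exists_monotone_block_inverse (E : ℕ → ℕ) (hE : StrictMono E) (L M : ℕ) :
    ∃ g : ℝ → ℝ, Monotone g ∧ ∀ a < M, g ((E a : ℝ) + 1) = ((a / L : ℕ) : ℝ) + 1 := by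
  refine ⟨fun t => (((((Finset.range M).filter fun a => (E a : ℝ) + 1 ≤ t).card - 1) / L : ℕ) : ℝ)
    + 1, fun s t hst => ?_, fun a ha => ?_⟩
  · dsimp only
    gcongr
  · have : ((Finset.range M).filter fun b => (E b : ℝ) + 1 ≤ (E a : ℝ) + 1)
        = Finset.range (a + 1) := by
      ext b
      simp only [Finset.mem_filter, Finset.mem_range, add_le_add_iff_right, Nat.cast_le,
        hE.le_iff_le]
      omega
    dsimp only
    rw [this, Finset.card_range, Nat.add_sub_cancel]

/-- The `A_k` distance does not increase under coordinatewise monotone maps. -/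
theorem AkDist2_map_le (k : ℕ) (p q : Measure (ℝ × ℝ)) [IsProbabilityMeasure p]
    [IsProbabilityMeasure q] (g h : ℝ → ℝ) (hg : Monotone g) (hh : Monotone h) :
    AkDist2 k (p.map (Prod.map g h)) (q.map (Prod.map g h)) ≤ AkDist2 k p q := by
  unfold AkDist2
  have hmeas : Measurable (Prod.map g h) := hg.measurable.prodMap hh.measurable
  have hrect : ∀ R : Set (ℝ × ℝ), IsRect2 R → MeasurableSet R := by
    rintro _ ⟨I, J, hI, hJ, rfl⟩
    exact hI.measurableSet.prod hJ.measurableSet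
  have hne : Nonempty {R : Fin k → Set (ℝ × ℝ) //
      (∀ i, IsRect2 (R i)) ∧ Pairwise fun i j => Disjoint (R i) (R j)} :=
    ⟨⟨fun _ => ∅, fun _ => ⟨∅, ∅, Set.ordConnected_empty, Set.ordConnected_empty, by simp⟩,
      fun _ _ _ => by simp⟩⟩
  refine ciSup_le fun R => ?_
  let R' : {R : Fin k → Set (ℝ × ℝ) //
      (∀ i, IsRect2 (R i)) ∧ Pairwise fun i j => Disjoint (R i) (R j)} :=
    ⟨fun i => Prod.map g h ⁻¹' R.1 i, fun i => by
      obtain ⟨I, J, hI, hJ, hR⟩ := R.2.1 i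
      exact ⟨g ⁻¹' I, h ⁻¹' J, hI.preimage_mono hg, hJ.preimage_mono hh, by
        dsimp only; rw [hR]; rfl⟩, fun i j hij => (R.2.2 hij).preimage _⟩
  refine le_ciSup_of_le ?_ R' (le_of_eq ?_)
  · refine ⟨∑ _i : Fin k, 1, ?_⟩
    rintro _ ⟨S, rfl⟩
    refine Finset.sum_le_sum fun i _ => ?_
    have hp := measureReal_le_one (μ := p) (s := S.1 i)
    have hq := measureReal_le_one (μ := q) (s := S.1 i)
    have hp0 := measureReal_nonneg (μ := p) (s := S.1 i)
    have hq0 := measureReal_nonneg (μ := q) (s := S.1 i)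
    simp only [Measure.real] at hp hq hp0 hq0
    exact abs_sub_le_iff.2 ⟨by linarith, by linarith⟩
  · refine Finset.sum_congr rfl fun i _ => ?_
    rw [Measure.map_apply hmeas (hrect _ (R.2.1 i)), Measure.map_apply hmeas (hrect _ (R.2.1 i))]

theorem labeledSamples_eq_sum (m : ℕ) (p q : Measure (ℝ × ℝ)) :
    labeledSamples m p q = ∑ ℓ : Fin m → Bool, (2 ^ m : ℝ≥0∞)⁻¹ •
      (Measure.pi fun i => if ℓ i then q else p).map fun xs => (xs, ℓ) := by
  ext s hs
  rw [labeledSamples, Measure.bind_apply hs (measurable_of_countable _).aemeasurable,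
    lintegral_fintype, Measure.finsetSum_apply]
  refine Finset.sum_congr rfl fun ℓ _ => ?_
  rw [PMF.toMeasure_apply_singleton _ _ (measurableSet_singleton ℓ),
    PMF.uniformOfFintype_apply, mul_comm, Measure.smul_apply, smul_eq_mul]
  simp

instance isProbabilityMeasure_labeled {m : ℕ} {p q : Measure (ℝ × ℝ)} [IsProbabilityMeasure p]
    [IsProbabilityMeasure q] (ℓ : Fin m → Bool) (i : Fin m) :
    IsProbabilityMeasure (if ℓ i then q else p) := by
  split_ifs <;> infer_instance

instance isProbabilityMeasure_labeledSamples (m : ℕ) (p q : Measure (ℝ × ℝ))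
    [IsProbabilityMeasure p] [IsProbabilityMeasure q] :
    IsProbabilityMeasure (labeledSamples m p q) := by
  constructor
  rw [labeledSamples_eq_sum, Measure.finsetSum_apply]
  have : ∀ ℓ : Fin m → Bool, ((2 ^ m : ℝ≥0∞)⁻¹ •
      (Measure.pi fun i => if ℓ i then q else p).map fun xs => (xs, ℓ)) Set.univ
        = (2 ^ m : ℝ≥0∞)⁻¹ := fun ℓ => by
    rw [Measure.smul_apply, Measure.map_apply (by fun_prop) MeasurableSet.univ]
    simp
  rw [Finset.sum_congr rfl fun ℓ _ => this ℓ]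
  simp only [Finset.sum_const, Finset.card_univ, Fintype.card_fun, Fintype.card_bool,
    Fintype.card_fin, nsmul_eq_mul]
  push_cast
  exact ENNReal.mul_inv_cancel (by simp) (by simp)

/-- Simultaneously permuting samples and labels preserves the law of the labeled sample. -/
theorem labeledSamples_map_perm (m : ℕ) (p q : Measure (ℝ × ℝ)) [IsProbabilityMeasure p]
    [IsProbabilityMeasure q] (ρ : Equiv.Perm (Fin m)) :
    (labeledSamples m p q).map (fun s => (s.1 ∘ ρ, s.2 ∘ ρ)) = labeledSamples m p q := by
  have hm1 : Measurable fun s : (Fin m → ℝ × ℝ) × (Fin m → Bool) => (s.1 ∘ ρ, s.2 ∘ ρ) := by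
    refine Measurable.prodMk ?_ ?_ <;> refine measurable_pi_lambda _ fun i => ?_
    · exact (measurable_pi_apply (ρ i)).comp measurable_fst
    · exact (measurable_pi_apply (ρ i)).comp measurable_snd
  have hm2 : Measurable fun xs : Fin m → ℝ × ℝ => xs ∘ ρ :=
    measurable_pi_lambda _ fun i => measurable_pi_apply (ρ i)
  have hpi : ∀ ℓ : Fin m → Bool,
      (Measure.pi fun i => if ℓ i then q else p).map (fun xs => xs ∘ ρ)
        = Measure.pi fun i => if (ℓ ∘ ρ) i then q else p := fun ℓ => by
    refine (Measure.pi_eq fun s hs => ?_).symm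
    rw [Measure.map_apply hm2 (MeasurableSet.univ_pi hs)]
    have : (fun xs : Fin m → ℝ × ℝ => xs ∘ ρ) ⁻¹' Set.univ.pi s
        = Set.univ.pi (fun i => s (ρ.symm i)) := by
      ext xs
      simp only [Set.mem_preimage, Set.mem_univ_pi, Function.comp]
      exact ⟨fun h i => by simpa using h (ρ.symm i), fun h i => by simpa using h (ρ i)⟩
    rw [this, Measure.pi_pi, ← Equiv.prod_comp ρ]
    simp
  rw [labeledSamples_eq_sum, Measure.map_finset_sum hm1.aemeasurable]
  rw [← Equiv.sum_comp (Equiv.arrowCongr ρ.symm (Equiv.refl Bool)) (fun ℓ : Fin m → Bool =>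
    (2 ^ m : ℝ≥0∞)⁻¹ • (Measure.pi fun i => if ℓ i then q else p).map fun xs => (xs, ℓ))]
  refine Finset.sum_congr rfl fun ℓ _ => ?_
  have hℓ : Equiv.arrowCongr ρ.symm (Equiv.refl Bool) ℓ = ℓ ∘ ρ := by ext; simp
  rw [hℓ, ← hpi, Measure.map_smul, Measure.map_map hm1 (by fun_prop),
    Measure.map_map (by fun_prop) hm2]
  rfl

/-- A labeled sample from uniform mixtures of push-forwards is a uniform mixture of
push-forwards of the labeled sample. -/
theorem labeledSamples_mixture (m L : ℕ) (hL : 0 < L) (p q : Measure (ℝ × ℝ))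
    [IsProbabilityMeasure p] [IsProbabilityMeasure q] (Φ : Fin L → ℝ × ℝ → ℝ × ℝ)
    (hΦ : ∀ u, Measurable (Φ u)) :
    labeledSamples m ((L : ℝ≥0∞)⁻¹ • ∑ u, p.map (Φ u)) ((L : ℝ≥0∞)⁻¹ • ∑ u, q.map (Φ u))
      = ((L : ℝ≥0∞) ^ m)⁻¹ • ∑ u : Fin m → Fin L,
          (labeledSamples m p q).map fun s => (fun i => Φ (u i) (s.1 i), s.2) := by
  have hm1 : ∀ u : Fin m → Fin L, Measurable
      fun s : (Fin m → ℝ × ℝ) × (Fin m → Bool) => (fun i => Φ (u i) (s.1 i), s.2) := fun u =>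
    (measurable_pi_lambda _ fun i =>
      (hΦ _).comp ((measurable_pi_apply i).comp measurable_fst)).prodMk measurable_snd
  have hm2 : ∀ u : Fin m → Fin L, Measurable
      fun xs : Fin m → ℝ × ℝ => fun i => Φ (u i) (xs i) := fun u =>
    measurable_pi_lambda _ fun i => (hΦ _).comp (measurable_pi_apply i)
  have hpi : ∀ ℓ : Fin m → Bool,
      (Measure.pi fun i => if ℓ i then ((L : ℝ≥0∞)⁻¹ • ∑ u, q.map (Φ u))
          else ((L : ℝ≥0∞)⁻¹ • ∑ u, p.map (Φ u)))
        = ((L : ℝ≥0∞) ^ m)⁻¹ • ∑ u : Fin m → Fin L,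
          (Measure.pi fun i => if ℓ i then q else p).map fun xs i => Φ (u i) (xs i) := by
    intro ℓ
    have hfin : ∀ r : Measure (ℝ × ℝ), IsProbabilityMeasure r →
        IsFiniteMeasure ((L : ℝ≥0∞)⁻¹ • ∑ u, r.map (Φ u)) := fun r _ =>
      Measure.smul_finite _ (by simpa using hL.ne')
    have hsf : ∀ i, SigmaFinite (if ℓ i then ((L : ℝ≥0∞)⁻¹ • ∑ u, q.map (Φ u))
          else ((L : ℝ≥0∞)⁻¹ • ∑ u, p.map (Φ u))) := fun i => by
      have := hfin p inferInstance
      have := hfin q inferInstance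
      split_ifs <;> infer_instance
    refine Measure.pi_eq fun s hs => ?_
    have h1 : ∀ i, (if ℓ i then ((L : ℝ≥0∞)⁻¹ • ∑ u, q.map (Φ u))
          else ((L : ℝ≥0∞)⁻¹ • ∑ u, p.map (Φ u))) (s i)
        = (L : ℝ≥0∞)⁻¹ * ∑ u : Fin L, (if ℓ i then q else p) (Φ u ⁻¹' s i) := fun i => by
      split_ifs <;> rw [Measure.smul_apply, Measure.finsetSum_apply, smul_eq_mul] <;>
        congr 1 <;> exact Finset.sum_congr rfl fun u _ => Measure.map_apply (hΦ u) (hs i)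
    rw [Finset.prod_congr rfl fun i _ => h1 i, Finset.prod_mul_distrib, Finset.prod_const,
      Finset.card_univ, Fintype.card_fin, ENNReal.inv_pow, Finset.prod_univ_sum,
      Measure.smul_apply, Measure.finsetSum_apply, smul_eq_mul, Fintype.piFinset_univ]
    congr 1
    refine Finset.sum_congr rfl fun u _ => ?_
    rw [Measure.map_apply (hm2 u) (MeasurableSet.univ_pi hs), ← Measure.pi_pi]
    rfl
  rw [labeledSamples_eq_sum, labeledSamples_eq_sum]
  simp_rw [hpi]
  have hsum : ∀ u : Fin m → Fin L, (∑ ℓ : Fin m → Bool, (2 ^ m : ℝ≥0∞)⁻¹ •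
        (Measure.pi fun i => if ℓ i then q else p).map fun xs => (xs, ℓ)).map
          (fun s => (fun i => Φ (u i) (s.1 i), s.2))
      = ∑ ℓ : Fin m → Bool, ((2 ^ m : ℝ≥0∞)⁻¹ •
        (Measure.pi fun i => if ℓ i then q else p).map fun xs => (xs, ℓ)).map
          (fun s => (fun i => Φ (u i) (s.1 i), s.2)) := fun u =>
    Measure.map_finset_sum (hm1 u).aemeasurable
  rw [Finset.sum_congr (rfl : (Finset.univ : Finset (Fin m → Fin L)) = _) fun u _ => hsum u]
  rw [Finset.sum_comm, Finset.smul_sum]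
  refine Finset.sum_congr rfl fun ℓ _ => ?_
  rw [Measure.map_smul, Measure.map_finset_sum (by fun_prop), smul_comm, Finset.smul_sum]
  congr 1
  refine Finset.sum_congr rfl fun u _ => ?_
  rw [Measure.map_smul, Measure.map_map (hm1 u) (by fun_prop),
    Measure.map_map (by fun_prop) (hm2 u)]
  rfl

theorem measurable_orderTuple (m : ℕ) : Measurable (orderTuple m) := by
  have h : ∀ f : ℝ × ℝ → ℝ, Measurable f → Measurable
      fun (s : (Fin m → ℝ × ℝ) × (Fin m → Bool)) (i : Fin m) =>
        (Finset.univ.filter fun j =>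
          f (s.1 j) < f (s.1 i) ∨ (f (s.1 j) = f (s.1 i) ∧ j < i)).card := by
    intro f hf
    have hc : ∀ j : Fin m, Measurable fun s : (Fin m → ℝ × ℝ) × (Fin m → Bool) => f (s.1 j) :=
      fun j => hf.comp ((measurable_pi_apply j).comp measurable_fst)
    refine measurable_pi_lambda _ fun i => ?_
    simp_rw [Finset.card_filter]
    refine Finset.measurable_sum _ fun j _ => Measurable.ite ?_ measurable_const measurable_const
    exact (measurableSet_lt (hc j) (hc i)).union
      ((measurableSet_eq_fun (hc j) (hc i)).inter (MeasurableSet.const _))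
  exact (h _ measurable_fst).prodMk ((h _ measurable_snd).prodMk measurable_snd)

/-- Almost surely all sampled points satisfy a property holding almost surely for `p` and `q`. -/
theorem ae_labeledSamples {m : ℕ} {p q : Measure (ℝ × ℝ)} [IsProbabilityMeasure p]
    [IsProbabilityMeasure q] {S : Set (ℝ × ℝ)} (hS : MeasurableSet S)
    (hp : p Sᶜ = 0) (hq : q Sᶜ = 0) :
    ∀ᵐ s ∂labeledSamples m p q, ∀ i, s.1 i ∈ S := by
  refine ae_all_iff.2 fun i => ?_
  have hmi : Measurable fun s : (Fin m → ℝ × ℝ) × (Fin m → Bool) => s.1 i :=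
    (measurable_pi_apply i).comp measurable_fst
  rw [ae_iff]
  change labeledSamples m p q ((fun s => s.1 i) ⁻¹' Sᶜ) = 0
  rw [labeledSamples_eq_sum, Measure.finsetSum_apply]
  refine Finset.sum_eq_zero fun ℓ _ => ?_
  rw [Measure.smul_apply, Measure.map_apply (by fun_prop) (hmi hS.compl), smul_eq_mul]
  refine mul_eq_zero_of_right _ ?_
  have := (measurePreserving_eval (fun i => if ℓ i then q else p) i).measure_preimage
    hS.compl.nullMeasurableSet
  refine Eq.trans this ?_
  split_ifs
  exacts [hq, hp]

/-- By Ramsey's theorem, every `[0, 1]`-valued function of labeled samples is, on points with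
distinct coordinates taken from suitable large sets, close to a function of the ranks. -/
theorem exists_rank_approximation (m M : ℕ) (hm : 0 < m) :
    ∃ N : ℕ, 0 < N ∧ ∀ A : (Fin m → ℝ × ℝ) × (Fin m → Bool) → ℝ,
      (∀ s, A s ∈ Set.Icc (0 : ℝ) 1) →
      ∃ E : ℕ → ℕ, StrictMono E ∧ (∀ a < M + M, E a < N) ∧
      ∃ G : (Fin m → ℕ) × (Fin m → ℕ) × (Fin m → Bool) → ℝ,
        (∀ o, G o ∈ Set.Icc (0 : ℝ) 1) ∧
        ∀ a b : Fin m → ℕ, Function.Injective a → Function.Injective b →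
          (∀ i, a i < M) → (∀ i, b i < M) → ∀ ℓ : Fin m → Bool,
          |A (fun i => ((E (a i) : ℝ) + 1, (E (M + b i) : ℝ) + 1), ℓ)
            - G (fun i => (Finset.univ.filter fun j => a j < a i).card,
                 fun i => (Finset.univ.filter fun j => b j < b i).card, ℓ)| ≤ 1 / 20 := by
  obtain ⟨N, hN⟩ := exists_strictMono_homogeneous
    ((Fin m → Fin m) → (Fin m → Fin m) → (Fin m → Bool) → Fin 21) (m + m) (M + M)
  refine ⟨N + 1, N.succ_pos, fun A hA => ?_⟩
  let level : ℝ → Fin 21 := fun x => ⟨min ⌊20 * x⌋₊ 20, by omega⟩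
  have hlevel : ∀ x ∈ Set.Icc (0 : ℝ) 1, |x - (level x : ℕ) / 20| ≤ 1 / 20 := by
    rintro x ⟨h0, h1⟩
    have hle : ⌊20 * x⌋₊ ≤ 20 := Nat.floor_le_of_le (by push_cast; linarith)
    have e : ((level x : ℕ) : ℝ) = ⌊20 * x⌋₊ := by
      simp only [level, min_eq_left hle]
    have h2 := Nat.floor_le (a := 20 * x) (by linarith)
    have h3 := Nat.lt_floor_add_one (20 * x)
    rw [e, abs_le]
    constructor <;> linarith
  obtain ⟨E, hE, hEN, v, hv⟩ := hN fun t σ τ ℓ =>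
    level (A (fun i => ((t (Fin.castAdd m (σ i)) : ℝ) + 1, (t (Fin.natAdd m (τ i)) : ℝ) + 1), ℓ))
  let clip : ℕ → Fin m := fun x => ⟨x % m, Nat.mod_lt _ hm⟩
  have hclip : ∀ x : Fin m, clip x = x := fun x => Fin.ext (Nat.mod_eq_of_lt x.2)
  refine ⟨E, hE, fun a ha => (hEN a ha).trans N.lt_succ_self,
    fun o => ((v (clip ∘ o.1) (clip ∘ o.2.1) o.2.2 : Fin 21) : ℕ) / 20, fun o => ⟨by positivity, ?_⟩,
    fun a b ha hb haM hbM ℓ => ?_⟩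
  · have : (((v (clip ∘ o.1) (clip ∘ o.2.1) o.2.2 : Fin 21) : ℕ) : ℝ) ≤ 20 := by
      exact_mod_cast Nat.lt_succ_iff.1 (v (clip ∘ o.1) (clip ∘ o.2.1) o.2.2).2
    linarith
  · obtain ⟨ta, hta, htar, σ, haσ, hσ⟩ := exists_strictMono_comp_rank a ha
    obtain ⟨tb, htb, htbr, τ, hbτ, hτ⟩ := exists_strictMono_comp_rank b hb
    have htaM : ∀ i, ta i < M := fun i => by
      obtain ⟨j, hj⟩ := htar i
      exact hj ▸ haM j
    have htbM : ∀ i, tb i < M := fun i => by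
      obtain ⟨j, hj⟩ := htbr i
      exact hj ▸ hbM j
    let t : Fin (m + m) → ℕ := Fin.append ta fun i => M + tb i
    have ht : StrictMono t := by
      intro i j hij
      induction i using Fin.addCases <;> induction j using Fin.addCases
      · simp only [t, Fin.append_left]
        exact hta (by simpa only [Fin.lt_def, Fin.val_castAdd] using hij)
      · rename_i i j
        have := htaM i
        simp only [t, Fin.append_left, Fin.append_right]
        omega
      · rename_i i j
        simp [Fin.lt_def] at hij
        omega
      · simp only [t, Fin.append_right]
        exact Nat.add_lt_add_left
          (htb (by simpa only [Fin.lt_def, Fin.val_natAdd, add_lt_add_iff_left] using hij)) M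
    have htM : ∀ i, t i < M + M := by
      intro i
      induction i using Fin.addCases with
      | left i => have := htaM i; simp only [t, Fin.append_left]; omega
      | right i => have := htbM i; simp only [t, Fin.append_right]; omega
    have key := congrFun (congrFun (congrFun (hv t ht htM) σ) τ) ℓ
    simp only [Function.comp, t, Fin.append_left, Fin.append_right] at key
    have h1 : clip ∘ (fun i => (Finset.univ.filter fun j => a j < a i).card) = σ := by
      ext i
      simp only [Function.comp, ← hσ, hclip]
    have h2 : clip ∘ (fun i => (Finset.univ.filter fun j => b j < b i).card) = τ := by
      ext i
      simp only [Function.comp, ← hτ, hclip]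
    have ha' : ∀ i, ta (σ i) = a i := fun i => (congrFun haσ i).symm
    have hb' : ∀ i, tb (τ i) = b i := fun i => (congrFun hbτ i).symm
    simp only [ha', hb'] at key
    simp only [h1, h2, ← key]
    exact hlevel _ (hA _)

/-- The permutation recording the ranks of an injective tuple of offsets. -/
def rankPerm {m L : ℕ} (u : Fin m → Fin L) : Equiv.Perm (Fin m) := (Tuple.sort u).symm

theorem rankPerm_lt_iff {m L : ℕ} {u : Fin m → Fin L} (hu : Function.Injective u)
    (i j : Fin m) : rankPerm u i < rankPerm u j ↔ u i < u j := by
  have ht : StrictMono (u ∘ Tuple.sort u) :=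
    (Tuple.monotone_sort u).strictMono_of_injective (hu.comp (Tuple.sort u).injective)
  rw [← ht.lt_iff_lt]
  simp [rankPerm]

theorem block_lt_iff {L x y u v : ℕ} (hu : u < L) (hv : v < L) :
    x * L + u < y * L + v ↔ x < y ∨ (x = y ∧ u < v) := by
  rcases lt_trichotomy x y with h | rfl | h
  · have : (x + 1) * L ≤ y * L := Nat.mul_le_mul_right L h
    simp only [h, true_or, iff_true]
    linarith
  · simp
  · have : (y + 1) * L ≤ x * L := Nat.mul_le_mul_right L h
    have h' : ¬ x < y := by omega
    have h'' : x ≠ y := by omega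
    simp only [h', h'', false_and, or_self, iff_false, not_lt]
    linarith

/-- Spreading ties by distinct offsets realizes tie-breaking by index, up to relabeling. -/
theorem card_block_lt {m L : ℕ} {u : Fin m → Fin L} (hu : Function.Injective u)
    (x : Fin m → ℕ) (f : Fin m → ℝ) (hf : ∀ i, f i = x i + 1) (i : Fin m) :
    (Finset.univ.filter fun j =>
        x (rankPerm u j) * L + u j < x (rankPerm u i) * L + u i).card =
      (Finset.univ.filter fun j =>
        f j < f (rankPerm u i) ∨ (f j = f (rankPerm u i) ∧ j < rankPerm u i)).card := by
  refine Finset.card_equiv (rankPerm u) fun j => ?_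
  simp [block_lt_iff (u j).2 (u i).2, hf, rankPerm_lt_iff hu]

theorem block_injective {m L : ℕ} {u : Fin m → Fin L} (hu : Function.Injective u)
    (x : Fin m → ℕ) : Function.Injective fun i => x i * L + u i := by
  intro i j hij
  apply hu
  have := congrArg (· % L) hij
  simpa [Nat.mul_add_mod', Nat.mod_eq_of_lt, Fin.ext_iff] using this

/-- The grid index of a coordinate. -/
noncomputable def gridIndex (t : ℝ) : ℕ := ⌊t⌋₊ - 1

theorem measurable_gridIndex : Measurable gridIndex :=
  (measurable_of_countable fun a : ℕ => a - 1).comp Nat.measurable_floor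

theorem gridIndex_add_one (a : ℕ) : gridIndex ((a : ℝ) + 1) = a := by
  have : ((a : ℝ) + 1) = ((a + 1 : ℕ) : ℝ) := by push_cast; ring
  rw [gridIndex, this, Nat.floor_natCast, Nat.add_sub_cancel]

/-- Sends a grid point into the `u`-th diagonal point of its block, enumerated by `E`. -/
noncomputable def blockPoint (E : ℕ → ℕ) (L M u : ℕ) (z : ℝ × ℝ) : ℝ × ℝ :=
  ((E (gridIndex z.1 * L + u) : ℝ) + 1, (E (M + (gridIndex z.2 * L + u)) : ℝ) + 1)

theorem measurable_blockPoint (E : ℕ → ℕ) (L M u : ℕ) : Measurable (blockPoint E L M u) := by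
  refine Measurable.prodMk ?_ ?_
  · exact (measurable_of_countable fun a : ℕ => (E (a * L + u) : ℝ) + 1).comp
      (measurable_gridIndex.comp measurable_fst)
  · exact (measurable_of_countable fun a : ℕ => (E (M + (a * L + u)) : ℝ) + 1).comp
      (measurable_gridIndex.comp measurable_snd)

/-- The points of the grid `[N₁] × [N₂]`. -/
def gridPoints (N₁ N₂ : ℕ) : Set (ℝ × ℝ) :=
  {z : ℝ × ℝ | ∃ i : Fin N₁, ∃ j : Fin N₂, z = ((i : ℝ) + 1, (j : ℝ) + 1)}

theorem measurableSet_gridPoints (N₁ N₂ : ℕ) : MeasurableSet (gridPoints N₁ N₂) := by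
  have : gridPoints N₁ N₂ = Set.range fun w : Fin N₁ × Fin N₂ => ((w.1 : ℝ) + 1, (w.2 : ℝ) + 1) := by
    ext z
    simp [gridPoints, eq_comm]
  rw [this]
  exact (Set.finite_range _).measurableSet

/-- Spreads each grid point uniformly over the diagonal of its block. -/
noncomputable def blockSpread (E : ℕ → ℕ) (L M : ℕ) (p : Measure (ℝ × ℝ)) : Measure (ℝ × ℝ) :=
  (L : ℝ≥0∞)⁻¹ • ∑ u : Fin L, p.map (blockPoint E L M u)

theorem isProbabilityMeasure_blockSpread (E : ℕ → ℕ) {L : ℕ} (hL : 0 < L) (M : ℕ)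
    (p : Measure (ℝ × ℝ)) [IsProbabilityMeasure p] :
    IsProbabilityMeasure (blockSpread E L M p) := by
  constructor
  rw [blockSpread, Measure.smul_apply, Measure.finsetSum_apply]
  have : ∀ u : Fin L, p.map (blockPoint E L M u) Set.univ = 1 := fun u => by
    rw [Measure.map_apply (measurable_blockPoint E L M u) MeasurableSet.univ]
    simp
  simp only [this, Finset.sum_const, Finset.card_univ, Fintype.card_fin, nsmul_eq_mul, mul_one,
    smul_eq_mul]
  exact ENNReal.inv_mul_cancel (by simpa using hL.ne') (by simp)

theorem block_lt_mul {n L : ℕ} (i : Fin n) (u : Fin L) : (i : ℕ) * L + u < n * L := by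
  have h1 : ((i : ℕ) + 1) * L ≤ n * L := Nat.mul_le_mul_right L i.2
  have h2 := u.2
  linarith

theorem gridSupported2_blockSpread {E : ℕ → ℕ} {n L N : ℕ}
    (hE : ∀ a < n * L + n * L, E a < N) {p : Measure (ℝ × ℝ)} (hp : GridSupported2 n n p) :
    GridSupported2 N N (blockSpread E L (n * L) p) := by
  change blockSpread E L (n * L) p (gridPoints N N)ᶜ = 0
  rw [blockSpread, Measure.smul_apply, Measure.finsetSum_apply, Finset.sum_eq_zero, smul_zero]
  intro u _
  rw [Measure.map_apply (measurable_blockPoint _ _ _ _) (measurableSet_gridPoints N N).compl]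
  refine measure_mono_null ?_ (hp : p (gridPoints n n)ᶜ = 0)
  rw [Set.preimage_compl, Set.compl_subset_compl]
  rintro _ ⟨i, j, rfl⟩
  have hi := block_lt_mul i u
  have hj := block_lt_mul j u
  exact ⟨⟨E (i * L + u), hE _ (by omega)⟩, ⟨E (n * L + (j * L + u)), hE _ (by omega)⟩, by
    simp [blockPoint, gridIndex_add_one]⟩

theorem AkDist2_le_blockSpread {E : ℕ → ℕ} (hE : StrictMono E) {n L : ℕ} (hL : 0 < L) (k : ℕ)
    {p q : Measure (ℝ × ℝ)} [IsProbabilityMeasure p] [IsProbabilityMeasure q]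
    (hp : GridSupported2 n n p) (hq : GridSupported2 n n q) :
    AkDist2 k p q ≤ AkDist2 k (blockSpread E L (n * L) p) (blockSpread E L (n * L) q) := by
  obtain ⟨g, hg, hgE⟩ := exists_monotone_block_inverse E hE L (n * L)
  obtain ⟨h, hh, hhE⟩ := exists_monotone_block_inverse (fun a => E (n * L + a))
    (fun a b hab => hE (by omega)) L (n * L)
  have hmeas : Measurable (Prod.map g h) := hg.measurable.prodMap hh.measurable
  have hmap : ∀ r : Measure (ℝ × ℝ), GridSupported2 n n r →
      (blockSpread E L (n * L) r).map (Prod.map g h) = r := by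
    intro r hr
    have hu : ∀ u : Fin L, (r.map (blockPoint E L (n * L) u)).map (Prod.map g h) = r := by
      intro u
      rw [Measure.map_map hmeas (measurable_blockPoint _ _ _ _)]
      conv_rhs => rw [← Measure.map_id (μ := r)]
      refine Measure.map_congr ?_
      have : ∀ᵐ z ∂r, z ∈ gridPoints n n := hr
      filter_upwards [this]
      rintro _ ⟨i, j, rfl⟩
      have hdiv : ∀ a : ℕ, (a * L + u) / L = a := fun a => by
        rw [mul_comm, Nat.mul_add_div hL, Nat.div_eq_of_lt u.2, add_zero]
      simp only [Function.comp, blockPoint, gridIndex_add_one, Prod.map, id]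
      rw [hgE _ (block_lt_mul i u), hhE _ (block_lt_mul j u), hdiv, hdiv]
    rw [blockSpread, Measure.map_smul, Measure.map_finset_sum hmeas.aemeasurable,
      Finset.sum_congr rfl fun u _ => hu u, Finset.sum_const, Finset.card_univ, Fintype.card_fin,
      ← Nat.cast_smul_eq_nsmul ℝ≥0∞, smul_smul,
      ENNReal.inv_mul_cancel (by simpa using hL.ne') (by simp), one_smul]
  have := isProbabilityMeasure_blockSpread E hL (n * L) p
  have := isProbabilityMeasure_blockSpread E hL (n * L) q
  have key := AkDist2_map_le k (blockSpread E L (n * L) p) (blockSpread E L (n * L) q) g h hg hh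
  rwa [hmap p hp, hmap q hq] at key

/-- Averages a function of ranks over all relabelings induced by random offsets. -/
noncomputable def offsetAverage (m L : ℕ) (G : (Fin m → ℕ) × (Fin m → ℕ) × (Fin m → Bool) → ℝ)
    (o : (Fin m → ℕ) × (Fin m → ℕ) × (Fin m → Bool)) : ℝ :=
  ((L : ℝ) ^ m)⁻¹ * ∑ u : Fin m → Fin L,
    G (o.1 ∘ rankPerm u, o.2.1 ∘ rankPerm u, o.2.2 ∘ rankPerm u)

theorem offsetAverage_mem_Icc {m L : ℕ} (hL : 0 < L)
    {G : (Fin m → ℕ) × (Fin m → ℕ) × (Fin m → Bool) → ℝ} (hG : ∀ o, G o ∈ Set.Icc (0 : ℝ) 1)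
    (o : (Fin m → ℕ) × (Fin m → ℕ) × (Fin m → Bool)) :
    offsetAverage m L G o ∈ Set.Icc (0 : ℝ) 1 := by
  refine ⟨mul_nonneg (by positivity) (Finset.sum_nonneg fun u _ => (hG _).1), ?_⟩
  have hL' : (0 : ℝ) < (L : ℝ) ^ m := by positivity
  rw [offsetAverage, inv_mul_le_iff₀ hL']
  refine (Finset.sum_le_sum fun u _ => (hG _).2).trans_eq ?_
  simp

theorem integrable_of_mem_Icc {α : Type*} [MeasurableSpace α] {μ : Measure α}
    [IsFiniteMeasure μ] {f : α → ℝ} (hf : Measurable f) (h : ∀ x, f x ∈ Set.Icc (0 : ℝ) 1) :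
    Integrable f μ :=
  Integrable.of_bound hf.aestronglyMeasurable 1 <| ae_of_all _ fun x => by
    rw [Real.norm_eq_abs, abs_of_nonneg (h x).1]
    exact (h x).2

theorem integral_mem_Icc {α : Type*} [MeasurableSpace α] {μ : Measure α}
    [IsProbabilityMeasure μ] {f : α → ℝ} (hf : Measurable f)
    (h : ∀ x, f x ∈ Set.Icc (0 : ℝ) 1) : ∫ x, f x ∂μ ∈ Set.Icc (0 : ℝ) 1 :=
  ⟨integral_nonneg fun x => (h x).1,
    (integral_mono (integrable_of_mem_Icc hf h) (integrable_const 1) fun x => (h x).2).trans_eq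
      (by simp)⟩

/-- Acceptance probabilities of a tester on spread distributions are approximated by those of
the averaged order-based tester on the original distributions. -/
theorem abs_integral_sub_integral_offsetAverage_le {m n L : ℕ} (hm : 0 < m)
    (hL : L = 20 * m * m) {E : ℕ → ℕ}
    {A : (Fin m → ℝ × ℝ) × (Fin m → Bool) → ℝ} (hA : Measurable A)
    (hA01 : ∀ s, A s ∈ Set.Icc (0 : ℝ) 1)
    {G : (Fin m → ℕ) × (Fin m → ℕ) × (Fin m → Bool) → ℝ} (hG : ∀ o, G o ∈ Set.Icc (0 : ℝ) 1)
    (hAG : ∀ a b : Fin m → ℕ, Function.Injective a → Function.Injective b →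
      (∀ i, a i < n * L) → (∀ i, b i < n * L) → ∀ ℓ : Fin m → Bool,
      |A (fun i => ((E (a i) : ℝ) + 1, (E (n * L + b i) : ℝ) + 1), ℓ)
        - G (fun i => (Finset.univ.filter fun j => a j < a i).card,
             fun i => (Finset.univ.filter fun j => b j < b i).card, ℓ)| ≤ 1 / 20)
    {p q : Measure (ℝ × ℝ)} [IsProbabilityMeasure p] [IsProbabilityMeasure q]
    (hp : GridSupported2 n n p) (hq : GridSupported2 n n q) :
    |∫ s, A s ∂labeledSamples m (blockSpread E L (n * L) p) (blockSpread E L (n * L) q)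
      - ∫ o, offsetAverage m L G o ∂orderDist m p q| ≤ 1 / 10 := by
  have hmL : m ≤ L := by rw [hL]; nlinarith
  have hL0 : 0 < L := hm.trans_le hmL
  have hLm : (0 : ℝ) < (L : ℝ) ^ m := by positivity
  have hΦ : ∀ u : Fin m → Fin L, Measurable fun s : (Fin m → ℝ × ℝ) × (Fin m → Bool) =>
      (fun i => blockPoint E L (n * L) (u i) (s.1 i), s.2) := fun u =>
    (measurable_pi_lambda _ fun i => (measurable_blockPoint _ _ _ _).comp
      ((measurable_pi_apply i).comp measurable_fst)).prodMk measurable_snd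
  have hperm : ∀ ρ : Equiv.Perm (Fin m), Measurable
      fun s : (Fin m → ℝ × ℝ) × (Fin m → Bool) => (s.1 ∘ ρ, s.2 ∘ ρ) := fun ρ =>
    (measurable_pi_lambda _ fun i => (measurable_pi_apply (ρ i)).comp measurable_fst).prodMk
      (measurable_pi_lambda _ fun i => (measurable_pi_apply (ρ i)).comp measurable_snd)
  have hGm : ∀ u : Fin m → Fin L, Measurable fun o : (Fin m → ℕ) × (Fin m → ℕ) × (Fin m → Bool) =>
      G (o.1 ∘ rankPerm u, o.2.1 ∘ rankPerm u, o.2.2 ∘ rankPerm u) := fun u =>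
    measurable_of_countable _
  let a : (Fin m → Fin L) → ℝ := fun u => ∫ s,
    A (fun i => blockPoint E L (n * L) (u i) (s.1 i), s.2) ∂labeledSamples m p q
  let b : (Fin m → Fin L) → ℝ := fun u => ∫ s,
    G ((orderTuple m s).1 ∘ rankPerm u, (orderTuple m s).2.1 ∘ rankPerm u,
      (orderTuple m s).2.2 ∘ rankPerm u) ∂labeledSamples m p q
  have hI1 : ∫ s, A s ∂labeledSamples m (blockSpread E L (n * L) p) (blockSpread E L (n * L) q)
      = ((L : ℝ) ^ m)⁻¹ * ∑ u, a u := by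
    rw [blockSpread, blockSpread, labeledSamples_mixture m L hL0 p q _
      fun u => measurable_blockPoint E L (n * L) u, integral_smul_measure,
      integral_finsetSum_measure]
    · simp only [ENNReal.toReal_inv, ENNReal.toReal_pow, ENNReal.toReal_natCast, smul_eq_mul]
      congr 1
      refine Finset.sum_congr rfl fun u _ => ?_
      rw [integral_map (hΦ u).aemeasurable hA.aestronglyMeasurable]
    · intro u _
      have := Measure.isProbabilityMeasure_map (μ := labeledSamples m p q) (hΦ u).aemeasurable
      exact integrable_of_mem_Icc hA hA01
  have hI2 : ∫ o, offsetAverage m L G o ∂orderDist m p q = ((L : ℝ) ^ m)⁻¹ * ∑ u, b u := by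
    rw [orderDist, integral_map (measurable_orderTuple m).aemeasurable
      (measurable_of_countable _).aestronglyMeasurable]
    simp only [offsetAverage]
    rw [integral_const_mul, integral_finsetSum]
    exact fun u _ => integrable_of_mem_Icc ((hGm u).comp (measurable_orderTuple m)) fun _ => hG _
  have hab : ∀ u, |a u - b u| ≤ 1 / 20 + if ¬ Function.Injective u then 1 else 0 := by
    intro u
    by_cases hu : Function.Injective u
    · have hae := ae_labeledSamples (m := m) (measurableSet_gridPoints n n) hp hq
      have ha : a u = ∫ s, A (fun i => blockPoint E L (n * L) (u i) (s.1 (rankPerm u i)),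
          s.2 ∘ rankPerm u) ∂labeledSamples m p q := by
        simp only [a]
        conv_lhs => rw [← labeledSamples_map_perm m p q (rankPerm u)]
        exact integral_map (hperm _).aemeasurable (hA.comp (hΦ u)).aestronglyMeasurable
      have hsub := integral_sub (μ := labeledSamples m p q)
        (integrable_of_mem_Icc ((hA.comp (hΦ u)).comp (hperm (rankPerm u))) fun _ => hA01 _)
        (integrable_of_mem_Icc ((hGm u).comp (measurable_orderTuple m)) fun _ => hG _)
      simp only [Function.comp_def] at hsub
      simp only [ha, b, Function.comp_def]
      rw [← hsub, ← Real.norm_eq_abs]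
      simp only [hu, not_true_eq_false, if_false, add_zero]
      refine (norm_integral_le_of_norm_le_const (C := 1 / 20) ?_).trans
        (by simp)
      filter_upwards [hae] with s hs
      choose x y hxy using hs
      have hx : ∀ i, (s.1 i).1 = ((x i : ℕ) : ℝ) + 1 := fun i => by rw [hxy]
      have hy : ∀ i, (s.1 i).2 = ((y i : ℕ) : ℝ) + 1 := fun i => by rw [hxy]
      have key := hAG (fun i => x (rankPerm u i) * L + u i) (fun i => y (rankPerm u i) * L + u i)
        (block_injective hu _) (block_injective hu _) (fun i => block_lt_mul _ _)
        (fun i => block_lt_mul _ _) (s.2 ∘ rankPerm u)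
      simp only [card_block_lt hu (fun i => (x i : ℕ)) (fun i => (s.1 i).1) hx,
        card_block_lt hu (fun i => (y i : ℕ)) (fun i => (s.1 i).2) hy] at key
      simp only [blockPoint, hx, hy, gridIndex_add_one, Real.norm_eq_abs]
      simp only [hx, hy] at key
      simpa only [orderTuple, Function.comp_def, hx, hy] using key
    · have h1 : a u ∈ Set.Icc (0 : ℝ) 1 := integral_mem_Icc (hA.comp (hΦ u)) fun _ => hA01 _
      have h2 : b u ∈ Set.Icc (0 : ℝ) 1 :=
        integral_mem_Icc ((hGm u).comp (measurable_orderTuple m)) fun _ => hG _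
      simp only [hu, not_false_eq_true, if_true]
      rw [abs_le]
      constructor <;> linarith [h1.1, h1.2, h2.1, h2.2]
  have hcard := card_not_injective_le m L hm hmL
  have hfrac : (m : ℝ) * m / L = 1 / 20 := by
    have : (0 : ℝ) < m := by exact_mod_cast hm
    rw [hL]
    push_cast
    field_simp
  rw [hfrac] at hcard
  rw [hI1, hI2, ← mul_sub, ← Finset.sum_sub_distrib, abs_mul, abs_of_pos (inv_pos.2 hLm),
    inv_mul_le_iff₀ hLm]
  refine (Finset.abs_sum_le_sum_abs _ _).trans ((Finset.sum_le_sum fun u _ => hab u).trans ?_)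
  rw [Finset.sum_add_distrib, Finset.sum_const, Finset.card_univ, Fintype.card_fun,
    Fintype.card_fin, Fintype.card_fin, Finset.sum_boole, nsmul_eq_mul]
  push_cast
  linarith

/-- **Lemma 3.1: reduction to order-based testers.**
For all `n, m, k` with `m < n` and all `ε > 0` there exist `N₁, N₂` such that: if some
(randomized, measurable) tester `A` on `m` labeled samples distinguishes `p = q` from
`‖p − q‖_{A_k} > ε` with probability `4/5` for every pair of distributions on
`[N₁] × [N₂]`, then some (randomized) order-based tester `A′` — a function of the order
tuple alone — distinguishes `p′ = q′` from `‖p′ − q′‖_{A_k} > ε` with probability `2/3`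
for every pair of distributions on `[n] × [n]`, given an order tuple drawn from
`D(p′, q′, m)`. -/
theorem order_based_tester_reduction (n m k : ℕ) (hm : 0 < m) (hmn : m < n) (hk : 0 < k)
    (ε : ℝ) (hε : 0 < ε) :
    ∃ N₁ N₂ : ℕ, 0 < N₁ ∧ 0 < N₂ ∧
      ((∃ A : (Fin m → ℝ × ℝ) × (Fin m → Bool) → ℝ,
          Measurable A ∧ (∀ s, A s ∈ Set.Icc (0 : ℝ) 1) ∧
          ∀ p q : Measure (ℝ × ℝ), IsProbabilityMeasure p → IsProbabilityMeasure q →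
            GridSupported2 N₁ N₂ p → GridSupported2 N₁ N₂ q →
            (p = q → (4 : ℝ) / 5 ≤ ∫ s, A s ∂(labeledSamples m p q)) ∧
            (ε < AkDist2 k p q → (4 : ℝ) / 5 ≤ ∫ s, (1 - A s) ∂(labeledSamples m p q))) →
        (∃ A' : (Fin m → ℕ) × (Fin m → ℕ) × (Fin m → Bool) → ℝ,
          Measurable A' ∧ (∀ o, A' o ∈ Set.Icc (0 : ℝ) 1) ∧
          ∀ p' q' : Measure (ℝ × ℝ), IsProbabilityMeasure p' → IsProbabilityMeasure q' →
            GridSupported2 n n p' → GridSupported2 n n q' →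
            (p' = q' → (2 : ℝ) / 3 ≤ ∫ o, A' o ∂(orderDist m p' q')) ∧
            (ε < AkDist2 k p' q' →
              (2 : ℝ) / 3 ≤ ∫ o, (1 - A' o) ∂(orderDist m p' q')))) := by
  have hL0 : 0 < 20 * m * m := by positivity
  obtain ⟨N, hN0, hN⟩ := exists_rank_approximation m (n * (20 * m * m)) hm
  refine ⟨N, N, hN0, hN0, ?_⟩
  rintro ⟨A, hA, hA01, hAtest⟩
  obtain ⟨E, hE, hEN, G, hG, hAG⟩ := hN A hA01
  refine ⟨offsetAverage m (20 * m * m) G, measurable_of_countable _,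
    offsetAverage_mem_Icc hL0 hG, fun p q hp hq hpn hqn => ?_⟩
  have happrox := abs_le.1 <|
    abs_integral_sub_integral_offsetAverage_le hm rfl hA hA01 hG hAG hpn hqn
  have hP := isProbabilityMeasure_blockSpread E hL0 (n * (20 * m * m)) p
  have hQ := isProbabilityMeasure_blockSpread E hL0 (n * (20 * m * m)) q
  obtain ⟨heq, hfar⟩ := hAtest _ _ hP hQ (gridSupported2_blockSpread hEN hpn)
    (gridSupported2_blockSpread hEN hqn)
  have hO : IsProbabilityMeasure (orderDist m p q) :=
    Measure.isProbabilityMeasure_map (measurable_orderTuple m).aemeasurable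
  refine ⟨fun hpq => ?_, fun hdist => ?_⟩
  · have := heq (by rw [hpq])
    linarith [happrox.2]
  · have := hfar (hdist.trans_le (AkDist2_le_blockSpread hE hL0 k hpn hqn))
    rw [integral_sub (integrable_const 1) (integrable_of_mem_Icc hA hA01)] at this
    rw [integral_sub (integrable_const 1) (integrable_of_mem_Icc (measurable_of_countable _)
      (offsetAverage_mem_Icc hL0 hG))]
    simp only [integral_const, probReal_univ, smul_eq_mul, mul_one] at this ⊢
    linarith [happrox.1]
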